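/- arXiv:1407.3705 — 2 statements merged into one kernel-verified Lean document; each statement's English description precedes it below -/
import Mathlib

section
/- Let Γ = ⟨x, y ∣ x² = y³⟩ be the trefoil knot group, and let ω = e^{2πi/3} (so ω² + ω + 1 = 0). For (s, t) ∈ ℂ², define ρ_{s,t}: Γ → SL₃(ℂ) on the generators by ρ_{s,t}(x) = [[1, 0, 0], [s, −1, 0], [t, 0, −1]] and ρ_{s,t}(y) = [[1, ω − 1, ω² − 1], [0, ω, 0], [0, 0, ω²]] (this is well defined since ρ_{s,t}(x)² = ρ_{s,t}(y)³ = Id₃). Then ρ_{s,t} is reducible if and only if s = 0 or t = 0 or s + t = 2. -/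
/-- The single relator `x² y⁻³` of the trefoil knot group. -/
def trefoilRels : Set (FreeGroup Bool) := {FreeGroup.of true ^ 2 * (FreeGroup.of false ^ 3)⁻¹}

/-- The trefoil knot group `⟨x, y ∣ x² = y³⟩`. -/
abbrev TrefoilGroup := PresentedGroup trefoilRels

/-- The generator `x`. -/
def trefX : TrefoilGroup := PresentedGroup.of true

/-- The generator `y`. -/
def trefY : TrefoilGroup := PresentedGroup.of false

/-- `ω = e^{2πi/3}`, a primitive cube root of unity. -/
noncomputable def omg : ℂ := Complex.exp (2 * Real.pi * Complex.I / 3)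

open Matrix

/-- A subspace stable under a generating set of a group is stable under the whole group. -/
theorem map_mem_of_closure_eq_top {G K V : Type*} [Group G] [Field K] [AddCommGroup V]
    [Module K V] [FiniteDimensional K V] (ρ : G →* Module.End K V) {S : Set G}
    (hS : Subgroup.closure S = ⊤) (W : Submodule K V) (hW : ∀ g ∈ S, ∀ v ∈ W, ρ g v ∈ W)
    (g : G) : ∀ v ∈ W, ρ g v ∈ W := by
  have hg : g ∈ Subgroup.closure S := hS ▸ Subgroup.mem_top g
  induction hg using Subgroup.closure_induction with
  | mem g hg => exact hW g hg
  | one => simp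
  | mul a b _ _ ha hb =>
    intro v hv
    rw [map_mul, Module.End.mul_apply]
    exact ha _ (hb v hv)
  | inv a _ ha =>
    intro v hv
    have hinv (w : V) : ρ a⁻¹ (ρ a w) = w := by
      rw [← Module.End.mul_apply, ← map_mul, inv_mul_cancel, map_one, Module.End.one_apply]
    have hinj : Function.Injective ((ρ a).restrict ha) := by
      intro u w huw
      have h : ρ a u = ρ a w := congrArg Subtype.val huw
      exact Subtype.ext (by rw [← hinv u, h, hinv])
    obtain ⟨w, hw⟩ := LinearMap.injective_iff_surjective.mp hinj ⟨v, hv⟩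
    have hwv : ρ a w = v := congrArg Subtype.val hw
    rw [← hwv, hinv]
    exact w.2

theorem closure_trefX_trefY : Subgroup.closure {trefX, trefY} = ⊤ := by
  rw [← PresentedGroup.closure_range_of trefoilRels]
  congr 1
  ext g
  simp [trefX, trefY, or_comm]

theorem omg_sq_add_omg_add_one : omg ^ 2 + omg + 1 = 0 := by
  have h : IsPrimitiveRoot omg 3 := by
    simpa [omg] using Complex.isPrimitiveRoot_exp 3 (by norm_num)
  have hsum := h.geom_sum_eq_zero (by norm_num)
  simp only [Finset.sum_range_succ, Finset.sum_range_zero] at hsum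
  linear_combination hsum

/-- The matrix of `x`. -/
def trefXMatrix (s t : ℂ) : Matrix (Fin 3) (Fin 3) ℂ := !![1, 0, 0; s, -1, 0; t, 0, -1]

/-- The matrix of `y`. -/
noncomputable def trefYMatrix : Matrix (Fin 3) (Fin 3) ℂ :=
  !![1, omg - 1, omg ^ 2 - 1; 0, omg, 0; 0, 0, omg ^ 2]

theorem trefXMatrix_mulVec (s t : ℂ) (v : Fin 3 → ℂ) :
    trefXMatrix s t *ᵥ v = ![v 0, s * v 0 - v 1, t * v 0 - v 2] := by
  ext i
  fin_cases i <;> simp [trefXMatrix, mulVec, dotProduct, Fin.sum_univ_three] <;> ring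

theorem trefYMatrix_mulVec (v : Fin 3 → ℂ) :
    trefYMatrix *ᵥ v =
      ![v 0 + (omg - 1) * v 1 + (omg ^ 2 - 1) * v 2, omg * v 1, omg ^ 2 * v 2] := by
  ext i
  fin_cases i <;> simp [trefYMatrix, mulVec, dotProduct, Fin.sum_univ_three]

/-- A subspace stable under `trefYMatrix` contains the components of its vectors along the
eigenvectors of `trefYMatrix`. -/
theorem eigencomponents_mem {W : Submodule ℂ (Fin 3 → ℂ)}
    (hy : ∀ v ∈ W, trefYMatrix *ᵥ v ∈ W) {v : Fin 3 → ℂ} (hv : v ∈ W) :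
    (v 0 - v 1 - v 2) • ![1, 0, 0] ∈ W ∧ v 1 • ![1, 1, 0] ∈ W ∧ v 2 • ![1, 0, 1] ∈ W := by
  have hω := omg_sq_add_omg_add_one
  have h1 := hy v hv
  have h2 := hy _ h1
  have hcomb (a b : ℂ) : (3⁻¹ : ℂ) • (v + a • trefYMatrix *ᵥ v +
      b • trefYMatrix *ᵥ (trefYMatrix *ᵥ v)) ∈ W :=
    W.smul_mem _ (W.add_mem (W.add_mem hv (W.smul_mem a h1)) (W.smul_mem b h2))
  refine ⟨?_, ?_, ?_⟩
  · convert hcomb 1 1 using 1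
    ext i
    fin_cases i <;> simp [trefYMatrix_mulVec, vecHead, vecTail] <;> grind
  · convert hcomb (omg ^ 2) omg using 1
    ext i
    fin_cases i <;> simp [trefYMatrix_mulVec, vecHead, vecTail] <;> grind
  · convert hcomb omg (omg ^ 2) using 1
    ext i
    fin_cases i <;> simp [trefYMatrix_mulVec, vecHead, vecTail] <;> grind

theorem eq_top_of_eigenvectors_mem {W : Submodule ℂ (Fin 3 → ℂ)} (h0 : ![1, 0, 0] ∈ W)
    (h1 : ![1, 1, 0] ∈ W) (h2 : ![1, 0, 1] ∈ W) : W = ⊤ := by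
  refine (Submodule.eq_top_iff').mpr fun v => ?_
  convert W.add_mem (W.add_mem (W.smul_mem (v 0 - v 1 - v 2) h0) (W.smul_mem (v 1) h1))
    (W.smul_mem (v 2) h2) using 1
  ext i
  fin_cases i <;> simp
  ring

theorem eq_bot_or_eq_top_of_stable {s t : ℂ} (hs : s ≠ 0) (ht : t ≠ 0) (hst : s + t ≠ 2)
    {W : Submodule ℂ (Fin 3 → ℂ)} (hx : ∀ v ∈ W, trefXMatrix s t *ᵥ v ∈ W)
    (hy : ∀ v ∈ W, trefYMatrix *ᵥ v ∈ W) : W = ⊥ ∨ W = ⊤ := by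
  rw [or_iff_not_imp_left]
  intro hbot
  have hfirst {v : Fin 3 → ℂ} (hv : v ∈ W) (hv0 : v 0 = 1) : ![2, s, t] ∈ W := by
    convert W.add_mem hv (hx v hv) using 1
    ext i
    fin_cases i <;> simp [trefXMatrix_mulVec, hv0]
    norm_num
  have hu : ![2, s, t] ∈ W := by
    obtain ⟨v, hv, hv0⟩ := W.exists_mem_ne_zero_of_ne_bot hbot
    obtain ⟨h0, h1, h2⟩ := eigencomponents_mem hy hv
    by_cases hv1 : v 1 = 0
    · by_cases hv2 : v 2 = 0
      · have hv3 : v 0 - v 1 - v 2 ≠ 0 := by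
          intro h
          apply hv0
          ext i
          fin_cases i <;> simp_all
        exact hfirst ((W.smul_mem_iff hv3).mp h0) rfl
      · exact hfirst ((W.smul_mem_iff hv2).mp h2) rfl
    · exact hfirst ((W.smul_mem_iff hv1).mp h1) rfl
  obtain ⟨h0, h1, h2⟩ := eigencomponents_mem hy hu
  have h : (2 : ℂ) - s - t ≠ 0 := fun h => hst (by linear_combination -h)
  exact eq_top_of_eigenvectors_mem ((W.smul_mem_iff h).mp h0) ((W.smul_mem_iff hs).mp h1)
    ((W.smul_mem_iff ht).mp h2)

/-- When `s = 0`, `t = 0` or `s + t = 2`, both matrices have a common left eigenvector. -/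
theorem exists_common_left_eigenvector {s t : ℂ} (h : s = 0 ∨ t = 0 ∨ s + t = 2) :
    ∃ l : (Fin 3 → ℂ) →ₗ[ℂ] ℂ, l ≠ 0 ∧ (∀ v, l (trefXMatrix s t *ᵥ v) = -l v) ∧
      ∃ μ : ℂ, ∀ v, l (trefYMatrix *ᵥ v) = μ * l v := by
  rcases h with rfl | rfl | h
  · refine ⟨LinearMap.proj 1, fun h => ?_, fun v => ?_, omg, fun v => ?_⟩
    · simpa using LinearMap.congr_fun h ![0, 1, 0]
    · simp [trefXMatrix_mulVec]
    · simp [trefYMatrix_mulVec]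
  · refine ⟨LinearMap.proj 2, fun h => ?_, fun v => ?_, omg ^ 2, fun v => ?_⟩
    · simpa using LinearMap.congr_fun h ![0, 0, 1]
    · simp [trefXMatrix_mulVec]
    · simp [trefYMatrix_mulVec]
  · let p (i : Fin 3) : (Fin 3 → ℂ) →ₗ[ℂ] ℂ := LinearMap.proj i
    refine ⟨p 0 - p 1 - p 2, fun h => ?_, fun v => ?_, 1, fun v => ?_⟩
    · simpa [p] using LinearMap.congr_fun h ![1, 0, 0]
    · simp [p, trefXMatrix_mulVec]
      linear_combination -v 0 * h
    · simp [p, trefYMatrix_mulVec]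
      ring

/-- **Lemma 9.7.** Let `ρ_{s,t} : Γ → SL₃(ℂ)` be the family of representations of the trefoil
knot group with `ρ_{s,t}(x) = [[1,0,0],[s,-1,0],[t,0,-1]]` and
`ρ_{s,t}(y) = [[1, ω-1, ω²-1],[0, ω, 0],[0, 0, ω²]]`.  Then `ρ_{s,t}` is reducible if and
only if `s = 0` or `t = 0` or `s + t = 2`. -/
theorem trefoil_SL3_family_reducible_iff
    (P : ℂ → ℂ → TrefoilGroup →* Matrix.SpecialLinearGroup (Fin 3) ℂ)
    (hP : ∀ s t : ℂ,
      ((P s t trefX : Matrix (Fin 3) (Fin 3) ℂ) = !![1, 0, 0; s, -1, 0; t, 0, -1]) ∧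
      ((P s t trefY : Matrix (Fin 3) (Fin 3) ℂ) =
        !![1, omg - 1, omg ^ 2 - 1; 0, omg, 0; 0, 0, omg ^ 2])) :
    ∀ s t : ℂ,
      (∃ W : Submodule ℂ (Fin 3 → ℂ), W ≠ ⊥ ∧ W ≠ ⊤ ∧
        (∀ γ : TrefoilGroup, ∀ v ∈ W, (P s t γ : Matrix (Fin 3) (Fin 3) ℂ).mulVec v ∈ W)) ↔
      (s = 0 ∨ t = 0 ∨ s + t = 2) := by
  intro s t
  have hX : (P s t trefX : Matrix (Fin 3) (Fin 3) ℂ) = trefXMatrix s t := (hP s t).1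
  have hY : (P s t trefY : Matrix (Fin 3) (Fin 3) ℂ) = trefYMatrix := (hP s t).2
  constructor
  · rintro ⟨W, hbot, htop, hW⟩
    by_contra! h
    have hx := hW trefX
    have hy := hW trefY
    rw [hX] at hx
    rw [hY] at hy
    exact (eq_bot_or_eq_top_of_stable h.1 h.2.1 h.2.2 hx hy).elim hbot htop
  · intro h
    obtain ⟨l, hl, hx, μ, hy⟩ := exists_common_left_eigenvector h
    refine ⟨LinearMap.ker l, LinearMap.ker_ne_bot_of_finrank_lt (by simp),
      fun h => hl (LinearMap.ker_eq_top.mp h),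
      map_mem_of_closure_eq_top ((LinearEquiv.automorphismGroup.toLinearMapMonoidHom.comp
        SpecialLinearGroup.toLin').comp (P s t)) closure_trefX_trefY _ ?_⟩
    rintro g (rfl | rfl) v hv
    · change (P s t trefX : Matrix (Fin 3) (Fin 3) ℂ) *ᵥ v ∈ LinearMap.ker l
      rw [hX, LinearMap.mem_ker, hx, LinearMap.mem_ker.mp hv, neg_zero]
    · change (P s t trefY : Matrix (Fin 3) (Fin 3) ℂ) *ᵥ v ∈ LinearMap.ker l
      rw [hY, LinearMap.mem_ker, hy, LinearMap.mem_ker.mp hv, mul_zero]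
end

section
/- Let Γ = ⟨x, y ∣ x² = y³⟩ be the trefoil knot group, ω = e^{2πi/3}, m = x y⁻¹, and for (s, t) ∈ ℂ² let ρ_{s,t}: Γ → SL₃(ℂ) be the representation with ρ_{s,t}(x) = [[1, 0, 0], [s, −1, 0], [t, 0, −1]] and ρ_{s,t}(y) = [[1, ω − 1, ω² − 1], [0, ω, 0], [0, 0, ω²]]. Then tr ρ_{s,t}(m) = 2 + (ω² − 1)s + (ω − 1)t and tr ρ_{s,t}(m⁻¹) = 2 + (ω − 1)s + (ω² − 1)t. Consequently, if ρ_{s,t} and ρ_{s',t'} are conjugate in SL₃(ℂ), then (s, t) = (s', t'). -/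
theorem omg_isPrimitiveRoot : IsPrimitiveRoot omg 3 := by
  simpa [omg] using Complex.isPrimitiveRoot_exp 3 (by norm_num)

theorem omg_pow_three : omg ^ 3 = 1 :=
  omg_isPrimitiveRoot.pow_eq_one

theorem one_add_omg_add_omg_sq : 1 + omg + omg ^ 2 = 0 := by
  simpa [Finset.sum_range_succ] using omg_isPrimitiveRoot.geom_sum_eq_zero (by norm_num)

theorem trace_conj {n R : Type*} [Fintype n] [DecidableEq n] [CommRing R]
    (g A : Matrix.SpecialLinearGroup n R) :
    Matrix.trace ((g * A * g⁻¹ : Matrix.SpecialLinearGroup n R) : Matrix n n R) =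
      Matrix.trace (A : Matrix n n R) := by
  rw [Matrix.SpecialLinearGroup.coe_mul, Matrix.trace_mul_comm,
    ← Matrix.SpecialLinearGroup.coe_mul, ← mul_assoc, inv_mul_cancel, one_mul]

/-- **Formula (35) and the injectivity step in the proof of Theorem 9.10.** With
`m = x y⁻¹` the meridian of the trefoil and `ρ_{s,t}` the standard family of `SL₃(ℂ)`
representations, one has `tr ρ_{s,t}(m) = 2 + (ω² - 1)s + (ω - 1)t` and
`tr ρ_{s,t}(m⁻¹) = 2 + (ω - 1)s + (ω² - 1)t`; consequently, if `ρ_{s,t}` and `ρ_{s',t'}`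
are conjugate in `SL₃(ℂ)` then `(s, t) = (s', t')`. -/
theorem trefoil_SL3_family_trace_and_injectivity
    (P : ℂ → ℂ → TrefoilGroup →* Matrix.SpecialLinearGroup (Fin 3) ℂ)
    (hP : ∀ s t : ℂ,
      ((P s t trefX : Matrix (Fin 3) (Fin 3) ℂ) = !![1, 0, 0; s, -1, 0; t, 0, -1]) ∧
      ((P s t trefY : Matrix (Fin 3) (Fin 3) ℂ) =
        !![1, omg - 1, omg ^ 2 - 1; 0, omg, 0; 0, 0, omg ^ 2])) :
    (∀ s t : ℂ,
      Matrix.trace ((P s t (trefX * trefY⁻¹) : Matrix (Fin 3) (Fin 3) ℂ)) =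
          2 + (omg ^ 2 - 1) * s + (omg - 1) * t ∧
      Matrix.trace ((P s t ((trefX * trefY⁻¹)⁻¹) : Matrix (Fin 3) (Fin 3) ℂ)) =
          2 + (omg - 1) * s + (omg ^ 2 - 1) * t) ∧
    (∀ s t s' t' : ℂ,
      (∃ g : Matrix.SpecialLinearGroup (Fin 3) ℂ,
        ∀ γ : TrefoilGroup, P s t γ = g * P s' t' γ * g⁻¹) →
      s = s' ∧ t = t') := by
  have hw := one_add_omg_add_omg_sq
  have hw3 := omg_pow_three
  have htr : ∀ s t : ℂ,
      Matrix.trace ((P s t (trefX * trefY⁻¹) : Matrix (Fin 3) (Fin 3) ℂ)) =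
          2 + (omg ^ 2 - 1) * s + (omg - 1) * t ∧
      Matrix.trace ((P s t ((trefX * trefY⁻¹)⁻¹) : Matrix (Fin 3) (Fin 3) ℂ)) =
          2 + (omg - 1) * s + (omg ^ 2 - 1) * t := by
    intro s t
    obtain ⟨hx, hy⟩ := hP s t
    constructor
    · rw [map_mul, map_inv, Matrix.SpecialLinearGroup.coe_mul,
        Matrix.SpecialLinearGroup.coe_inv, hx, hy]
      simp [Matrix.adjugate_fin_three, Matrix.trace_fin_three]
      linear_combination (1 - s - t) * hw3 - hw
    · rw [mul_inv_rev, inv_inv, map_mul, map_inv, Matrix.SpecialLinearGroup.coe_mul,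
        Matrix.SpecialLinearGroup.coe_inv, hx, hy]
      simp [Matrix.adjugate_fin_three, Matrix.trace_fin_three]
      linear_combination -hw
  refine ⟨htr, ?_⟩
  rintro s t s' t' ⟨g, hg⟩
  have htrace : ∀ γ, Matrix.trace (P s t γ : Matrix (Fin 3) (Fin 3) ℂ) =
      Matrix.trace (P s' t' γ : Matrix (Fin 3) (Fin 3) ℂ) := fun γ => by
    rw [hg γ, trace_conj]
  have h₁ := htrace (trefX * trefY⁻¹)
  have h₂ := htrace (trefX * trefY⁻¹)⁻¹
  rw [(htr s t).1, (htr s' t').1] at h₁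
  rw [(htr s t).2, (htr s' t').2] at h₂
  have hsq : omg ^ 2 = -1 - omg := by linear_combination hw
  rw [hsq] at h₁ h₂
  constructor
  · linear_combination ((-1 - omg - 1) * h₁ - (omg - 1) * h₂) * (-1 - 2 * omg) / 9 +
      (s - s') * (4 / 3) * hw
  · linear_combination ((-1 - omg - 1) * h₂ - (omg - 1) * h₁) * (-1 - 2 * omg) / 9 +
      (t - t') * (4 / 3) * hw
end
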